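/- Every bipartite simple graph G with at least one edge and with maximum degree Δ(G) ≤ 3 is interval colorable. -/

import Mathlib

/-- A proper edge-coloring of `G` with colors `1,…,t` is an *interval `t`-coloring* if
all colors `1,…,t` are used, the colors of edges incident to each vertex are distinct
(i.e. the coloring is proper), and form an interval of consecutive integers. -/
def IsIntervalColoring {V : Type*} (G : SimpleGraph V) (t : ℕ) (c : G.edgeSet → ℕ) : Prop :=
  (∀ e, 1 ≤ c e ∧ c e ≤ t) ∧
  (∀ e₁ e₂ : G.edgeSet, e₁ ≠ e₂ → (∃ v, v ∈ (e₁ : Sym2 V) ∧ v ∈ (e₂ : Sym2 V)) →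
      c e₁ ≠ c e₂) ∧
  (∀ k, 1 ≤ k → k ≤ t → ∃ e, c e = k) ∧
  (∀ v : V, ∀ k₁ k₂ k : ℕ,
    (∃ e₁ : G.edgeSet, v ∈ (e₁ : Sym2 V) ∧ c e₁ = k₁) →
    (∃ e₂ : G.edgeSet, v ∈ (e₂ : Sym2 V) ∧ c e₂ = k₂) →
    k₁ ≤ k → k ≤ k₂ →
    ∃ e : G.edgeSet, v ∈ (e : Sym2 V) ∧ c e = k)

/-- `G` is *interval colorable* if it has an interval `t`-coloring for some `t ≥ 1`. -/
def IntervalColorable {V : Type*} (G : SimpleGraph V) : Prop :=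
  ∃ t : ℕ, 0 < t ∧ ∃ c : G.edgeSet → ℕ, IsIntervalColoring G t c

/-- `(X, Y)` is a bipartition of the graph `G`. -/
def IsBipartition {V : Type*} (G : SimpleGraph V) (X Y : Set V) : Prop :=
  Disjoint X Y ∧ X ∪ Y = Set.univ ∧
    ∀ u v : V, G.Adj u v → (u ∈ X ∧ v ∈ Y) ∨ (u ∈ Y ∧ v ∈ X)

/-- `G` is bipartite. -/
def IsBipartite {V : Type*} (G : SimpleGraph V) : Prop :=
  ∃ X Y : Set V, IsBipartition G X Y

/-- A proper edge-coloring with positive colors in which the colors at every vertex form an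
interval; the set of all colors used may have gaps. -/
def IsLocallyIntervalColoring {V : Type*} (G : SimpleGraph V) (c : G.edgeSet → ℕ) : Prop :=
  (∀ e, 1 ≤ c e) ∧
  (∀ e₁ e₂ : G.edgeSet, e₁ ≠ e₂ → (∃ v, v ∈ (e₁ : Sym2 V) ∧ v ∈ (e₂ : Sym2 V)) →
      c e₁ ≠ c e₂) ∧
  (∀ v : V, ∀ e₁ e₂ : G.edgeSet, v ∈ (e₁ : Sym2 V) → v ∈ (e₂ : Sym2 V) →
    ∀ k, c e₁ ≤ k → k ≤ c e₂ → ∃ e : G.edgeSet, v ∈ (e : Sym2 V) ∧ c e = k)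

/-- Lowering every color above an unused color `k` by one keeps a locally interval coloring. -/
theorem IsLocallyIntervalColoring.shift {V : Type*} {G : SimpleGraph V} {c : G.edgeSet → ℕ}
    (hc : IsLocallyIntervalColoring G c) {k : ℕ} (hk : 1 ≤ k) (hunused : ∀ e, c e ≠ k) :
    IsLocallyIntervalColoring G (fun e => if k < c e then c e - 1 else c e) := by
  obtain ⟨hpos, hproper, hint⟩ := hc
  refine ⟨fun e => ?_, fun e₁ e₂ hne hv => ?_, fun v e₁ e₂ h₁ h₂ j hj₁ hj₂ => ?_⟩
  · have := hpos e
    dsimp only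
    split_ifs <;> omega
  · have := hproper e₁ e₂ hne hv
    have := hunused e₁
    have := hunused e₂
    dsimp only
    split_ifs <;> omega
  · have hside : ¬ (c e₁ < k ∧ k < c e₂) := fun h => by
      obtain ⟨e, -, he⟩ := hint v e₁ e₂ h₁ h₂ k h.1.le h.2.le
      exact hunused e he
    have := hunused e₁
    have := hunused e₂
    dsimp only at hj₁ hj₂ ⊢
    by_cases hlt : k < c e₂
    · rw [if_pos hlt] at hj₂
      rw [if_pos (by omega)] at hj₁
      obtain ⟨e, hev, he⟩ := hint v e₁ e₂ h₁ h₂ (j + 1) (by omega) (by omega)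
      exact ⟨e, hev, by rw [if_pos (by omega)]; omega⟩
    · rw [if_neg hlt] at hj₂
      have : c e₁ ≤ j := by split_ifs at hj₁ <;> omega
      obtain ⟨e, hev, he⟩ := hint v e₁ e₂ h₁ h₂ j this hj₂
      exact ⟨e, hev, by rw [if_neg (by omega)]; exact he⟩

theorem IsLocallyIntervalColoring.intervalColorable {V : Type*} [Finite V] {G : SimpleGraph V}
    (hedge : G.edgeSet.Nonempty) {c : G.edgeSet → ℕ} (hc : IsLocallyIntervalColoring G c) :
    IntervalColorable G := by
  classical
  have := Fintype.ofFinite G.edgeSet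
  induction hn : ∑ e, c e using Nat.strong_induction_on generalizing c with
  | _ n ih =>
    have : Nonempty G.edgeSet := hedge.to_subtype
    obtain ⟨e₀, he₀⟩ := Finite.exists_max c
    by_cases hall : ∀ k, 1 ≤ k → k ≤ c e₀ → ∃ e, c e = k
    · refine ⟨c e₀, hc.1 e₀, c, fun e => ⟨hc.1 e, he₀ e⟩, hc.2.1, hall, ?_⟩
      rintro v k₁ k₂ k ⟨e₁, h₁, rfl⟩ ⟨e₂, h₂, rfl⟩ hk₁ hk₂
      exact hc.2.2 v e₁ e₂ h₁ h₂ k hk₁ hk₂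
    · push Not at hall
      obtain ⟨k, hk₁, hk₂, hunused⟩ := hall
      refine ih _ ?_ (hc.shift hk₁ hunused) rfl
      rw [← hn]
      refine Finset.sum_lt_sum (fun e _ => ?_) ⟨e₀, Finset.mem_univ _, ?_⟩
      · split_ifs <;> omega
      · have := hunused e₀
        rw [if_pos (by omega)]
        omega

/-- If all degrees are at most `k`, some permutation moves every vertex to a neighbor, except that
it may fix vertices of degree less than `k`. -/
theorem SimpleGraph.exists_injective_adj_or_eq {V : Type*} [Finite V] (G : SimpleGraph V)
    {k : ℕ} (hk : 0 < k) (hdeg : ∀ v, (G.neighborSet v).ncard ≤ k) :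
    ∃ f : V → V, Function.Injective f ∧
      ∀ v, G.Adj v (f v) ∨ (f v = v ∧ (G.neighborSet v).ncard < k) := by
  classical
  have := Fintype.ofFinite V
  let w : V → V → ℕ := fun v u =>
    (if G.Adj v u then 1 else 0) + if v = u then k - (G.neighborSet v).ncard else 0
  have hcard : ∀ v, ∑ u, (if G.Adj v u then 1 else 0) = (G.neighborSet v).ncard := fun v => by
    rw [Finset.sum_boole, Set.ncard_eq_toFinset_card']
    simp only [Nat.cast_id]
    congr 1
    ext u
    simp
  have hrow : ∀ v, ∑ u, w v u = k := fun v => by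
    have := hdeg v
    simp only [w, Finset.sum_add_distrib, hcard, Finset.sum_ite_eq, Finset.mem_univ, if_true]
    omega
  have hsymm : ∀ v u, w v u = w u v := fun v u => by
    by_cases h : v = u
    · rw [h]
    · simp only [w, G.adj_comm v u, h, Ne.symm h, if_false]
  let t : V → Finset V := fun v => Finset.univ.filter fun u => w v u ≠ 0
  have hhall : ∀ s : Finset V, s.card ≤ (s.biUnion t).card := fun s => by
    refine Nat.le_of_mul_le_mul_right ?_ hk
    calc s.card * k = ∑ v ∈ s, ∑ u, w v u := by simp [hrow]
      _ = ∑ v ∈ s, ∑ u ∈ s.biUnion t, w v u := by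
        refine Finset.sum_congr rfl fun v hv => (Finset.sum_subset (Finset.subset_univ _) ?_).symm
        intro u _ hu
        by_contra hne
        exact hu (Finset.mem_biUnion.2 ⟨v, hv, by simpa [t] using hne⟩)
      _ = ∑ u ∈ s.biUnion t, ∑ v ∈ s, w v u := Finset.sum_comm
      _ ≤ ∑ u ∈ s.biUnion t, ∑ v, w v u :=
        Finset.sum_le_sum fun u _ => Finset.sum_le_sum_of_subset (Finset.subset_univ _)
      _ = (s.biUnion t).card * k := by simp [hsymm _, hrow]
  obtain ⟨f, hf, hft⟩ := (Finset.all_card_le_biUnion_card_iff_exists_injective t).1 hhall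
  refine ⟨f, hf, fun v => ?_⟩
  have hw : w v (f v) ≠ 0 := by simpa [t] using hft v
  by_cases hadj : G.Adj v (f v)
  · exact Or.inl hadj
  · refine Or.inr ?_
    simp only [w, hadj, if_false, zero_add] at hw
    split_ifs at hw with h
    · exact ⟨h.symm, by omega⟩
    · exact absurd rfl hw

/-- A finite bipartite graph with maximum degree at most `k` has a matching covering all vertices
of degree `k`. -/
theorem SimpleGraph.exists_matching_covering_degree {V : Type*} [Finite V] (G : SimpleGraph V)
    {X : Set V} (hX : ∀ u v, G.Adj u v → (u ∈ X ↔ v ∉ X)) {k : ℕ} (hk : 0 < k)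
    (hdeg : ∀ v, (G.neighborSet v).ncard ≤ k) :
    ∃ M : SimpleGraph V, M ≤ G ∧ (∀ u v w, M.Adj u v → M.Adj u w → v = w) ∧
      ∀ v, (G.neighborSet v).ncard = k → ∃ w, M.Adj v w := by
  obtain ⟨f, hf, hfG⟩ := G.exists_injective_adj_or_eq hk hdeg
  let M : SimpleGraph V :=
    { Adj := fun u v => G.Adj u v ∧ ((u ∈ X ∧ f u = v) ∨ (v ∈ X ∧ f v = u))
      symm := ⟨fun u v h => ⟨h.1.symm, h.2.symm⟩⟩
      loopless := ⟨fun u h => G.loopless.irrefl u h.1⟩ }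
  refine ⟨M, fun u v h => h.1, ?_, fun v hv => ?_⟩
  · rintro u v w ⟨huv, h₁⟩ ⟨huw, h₂⟩
    have := hX u v huv
    have := hX u w huw
    rcases h₁ with ⟨hu, rfl⟩ | ⟨hv, h₁⟩ <;> rcases h₂ with ⟨hu', rfl⟩ | ⟨hw, h₂⟩
    · rfl
    · tauto
    · tauto
    · exact hf (h₁.trans h₂.symm)
  · by_cases hvX : v ∈ X
    · rcases hfG v with h | ⟨-, h⟩
      · exact ⟨f v, h, Or.inl ⟨hvX, rfl⟩⟩
      · omega
    · obtain ⟨z, rfl⟩ := Finite.surjective_of_injective hf v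
      rcases hfG z with h | ⟨h, h'⟩
      · exact ⟨z, h.symm, Or.inr ⟨(hX _ _ h).2 hvX, rfl⟩⟩
      · rw [h] at hv
        omega

theorem SimpleGraph.exists_isLocallyIntervalColoring {V : Type*} [Finite V] (G : SimpleGraph V)
    {X : Set V} (hX : ∀ u v, G.Adj u v → (u ∈ X ↔ v ∉ X))
    (hdeg : ∀ v, (G.neighborSet v).ncard ≤ 3) :
    ∃ c : G.edgeSet → ℕ, IsLocallyIntervalColoring G c := by
  classical
  obtain ⟨M₀, hM₀G, hM₀, hM₀cover⟩ := G.exists_matching_covering_degree hX (by norm_num) hdeg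
  -- the edges of `M₀` that have an end of degree three
  let M : SimpleGraph V :=
    { Adj := fun u v => M₀.Adj u v ∧ ((G.neighborSet u).ncard = 3 ∨ (G.neighborSet v).ncard = 3)
      symm := ⟨fun u v h => ⟨h.1.symm, h.2.symm⟩⟩
      loopless := ⟨fun u h => M₀.loopless.irrefl u h.1⟩ }
  have hMG : M ≤ G := fun u v h => hM₀G h.1
  have hM : ∀ u v w, M.Adj u v → M.Adj u w → v = w := fun u v w h h' => hM₀ u v w h.1 h'.1
  have hMcover : ∀ v, (G.neighborSet v).ncard = 3 → ∃ w, M.Adj v w := fun v hv => by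
    obtain ⟨w, hw⟩ := hM₀cover v hv
    exact ⟨w, hw, Or.inl hv⟩
  have hKset : ∀ v, (G \ M).neighborSet v = G.neighborSet v \ M.neighborSet v := fun v => by
    ext w
    simp
  have hMsub : ∀ v, M.neighborSet v ⊆ G.neighborSet v := fun v w h => hMG h
  have hMone : ∀ v w, M.Adj v w → (M.neighborSet v).ncard = 1 := fun v w h =>
    Set.ncard_eq_one.2 ⟨w, by
      ext z
      exact ⟨fun hz => hM v z w hz h, fun hz => by rw [Set.mem_singleton_iff.1 hz]; exact h⟩⟩
  have hKcard : ∀ v, ((G \ M).neighborSet v).ncard + (M.neighborSet v).ncard =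
      (G.neighborSet v).ncard := fun v => by
    rw [hKset]
    exact Set.ncard_sdiff_add_ncard_of_subset (hMsub v)
  have hKdeg : ∀ v, ((G \ M).neighborSet v).ncard ≤ 2 := fun v => by
    have := hKcard v
    have := hdeg v
    by_cases h : (G.neighborSet v).ncard = 3
    · obtain ⟨w, hw⟩ := hMcover v h
      have := hMone v w hw
      omega
    · omega
  obtain ⟨N, hNK, hN, hNcover⟩ := (G \ M).exists_matching_covering_degree
    (fun u v h => hX u v h.1) (by norm_num) hKdeg
  have hNM : ∀ u v, N.Adj u v → ¬ M.Adj u v := fun u v h => (hNK h).2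
  have hrest : ∀ u v w, G.Adj u v → ¬ M.Adj u v → ¬ N.Adj u v → G.Adj u w → ¬ M.Adj u w →
      ¬ N.Adj u w → v = w := by
    intro u v w h₁ h₂ h₃ h₁' h₂' h₃'
    by_contra hne
    have hsub : ({v, w} : Set V) ⊆ (G \ M).neighborSet u := by
      rintro z (rfl | rfl)
      exacts [⟨h₁, h₂⟩, ⟨h₁', h₂'⟩]
    have heq := Set.eq_of_subset_of_ncard_le hsub (by rw [Set.ncard_pair hne]; exact hKdeg u)
    obtain ⟨z, hz⟩ := hNcover u (by rw [← heq, Set.ncard_pair hne])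
    have hzK : z ∈ (G \ M).neighborSet u := hNK hz
    rw [← heq] at hzK
    rcases hzK with rfl | rfl
    exacts [h₃ hz, h₃' hz]
  let P : V → Prop := fun a => (G.neighborSet a).ncard ≠ 3 ∧ ∃ w, N.Adj a w
  let c : Sym2 V → ℕ := fun e =>
    if e ∈ N.edgeSet then 2 else if e ∈ M.edgeSet then (if ∃ a ∈ e, P a then 1 else 4) else 3
  have hcN : ∀ u v, N.Adj u v → c s(u, v) = 2 := fun u v h => if_pos h
  have hcM : ∀ u v, M.Adj u v → c s(u, v) = if P u ∨ P v then 1 else 4 := fun u v h => by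
    have h' : ¬ N.Adj u v := fun h' => hNM u v h' h
    simp [c, h, h']
  have hcK : ∀ u v, ¬ M.Adj u v → ¬ N.Adj u v → c s(u, v) = 3 := fun u v h h' => by
    simp [c, h, h']
  have hpair : ∀ v u w, G.Adj v u → G.Adj v w → u ≠ w → 2 ≤ (G.neighborSet v).ncard := by
    intro v u w hu hw hne
    rw [← Set.ncard_pair hne]
    refine Set.ncard_le_ncard ?_
    rintro z (rfl | rfl)
    exacts [hu, hw]
  have hinterval : ∀ v u w, G.Adj v u → G.Adj v w → ∀ k, c s(v, u) ≤ k → k ≤ c s(v, w) →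
      ∃ z, G.Adj v z ∧ c s(v, z) = k := by
    intro v u w hu hw k hku hkw
    by_cases hk₁ : c s(v, u) = k
    · exact ⟨u, hu, hk₁⟩
    by_cases hk₂ : c s(v, w) = k
    · exact ⟨w, hw, hk₂⟩
    have hne : u ≠ w := by
      rintro rfl
      omega
    have hdeg2 := hpair v u w hu hw hne
    have hcard := hKcard v
    by_cases hMu : M.Adj v u
    · -- the colors are `1` and `3`
      have hMw : ¬ M.Adj v w := fun h => hne (hM v u w hMu h)
      have hone := hMone v u hMu
      have hcu := hcM v u hMu
      have hcw : c s(v, w) = 2 ∨ c s(v, w) = 3 := by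
        by_cases h : N.Adj v w
        exacts [Or.inl (hcN v w h), Or.inr (hcK v w hMw h)]
      have hP : P v ∨ P u := by
        by_contra h
        rw [if_neg h] at hcu
        omega
      rw [if_pos hP] at hcu
      have hNv : ∃ z, N.Adj v z := by
        by_cases h3 : (G.neighborSet v).ncard = 3
        · exact hNcover v (by omega)
        · rcases hP with hP | hP
          · exact hP.2
          · rcases hMu.2 with h | h
            exacts [absurd h h3, absurd h hP.1]
      obtain ⟨z, hz⟩ := hNv
      refine ⟨z, (hNK hz).1, ?_⟩
      rw [hcN v z hz]
      omega
    · have hcu : 2 ≤ c s(v, u) := by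
        by_cases h : N.Adj v u
        exacts [(hcN v u h).ge, by rw [hcK v u hMu h]; norm_num]
      have hMw : M.Adj v w := by
        by_contra h
        have : c s(v, w) ≤ 3 := by
          by_cases h' : N.Adj v w
          exacts [by rw [hcN v w h']; norm_num, (hcK v w h h').le]
        omega
      have hone := hMone v w hMw
      have hcw := hcM v w hMw
      split_ifs at hcw with hP
      · omega
      have hNu : N.Adj v u := by
        by_contra h
        have := hcK v u hMu h
        omega
      have h3 : (G.neighborSet v).ncard = 3 := by
        by_contra h3
        exact hP (Or.inl ⟨h3, u, hNu⟩)
      obtain ⟨z, hz, hzu⟩ := Set.exists_ne_of_one_lt_ncard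
        (s := (G \ M).neighborSet v) (by omega) u
      refine ⟨z, hz.1, ?_⟩
      rw [hcK v z hz.2 fun h => hzu (hN v z u h hNu)]
      have := hcN v u hNu
      omega
  have hproper : ∀ v u w, G.Adj v u → G.Adj v w → c s(v, u) = c s(v, w) → u = w := by
    intro v u w hu hw heq
    have key : ∀ x, (N.Adj v x ∧ c s(v, x) = 2) ∨
        (M.Adj v x ∧ (c s(v, x) = 1 ∨ c s(v, x) = 4)) ∨
        (¬ M.Adj v x ∧ ¬ N.Adj v x ∧ c s(v, x) = 3) := fun x => by
      by_cases hNx : N.Adj v x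
      · exact Or.inl ⟨hNx, hcN v x hNx⟩
      by_cases hMx : M.Adj v x
      · refine Or.inr (Or.inl ⟨hMx, ?_⟩)
        rw [hcM v x hMx]
        split_ifs <;> simp
      · exact Or.inr (Or.inr ⟨hMx, hNx, hcK v x hMx hNx⟩)
    rcases key u with ⟨h₁, h₂⟩ | ⟨h₁, h₂⟩ | ⟨h₁, h₂, h₃⟩ <;>
      rcases key w with ⟨h₁', h₂'⟩ | ⟨h₁', h₂'⟩ | ⟨h₁', h₂', h₃'⟩ <;>
      first
        | exact hN v u w h₁ h₁'
        | exact hM v u w h₁ h₁'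
        | exact hrest v u w hu h₁ h₂ hw h₁' h₂'
        | omega
  refine ⟨fun e => c e, fun e => ?_, ?_, ?_⟩
  · dsimp only [c]
    split_ifs <;> norm_num
  · rintro ⟨e₁, h₁⟩ ⟨e₂, h₂⟩ hne ⟨v, hv₁, hv₂⟩ heq
    obtain ⟨u, rfl⟩ := Sym2.mem_iff_exists.1 hv₁
    obtain ⟨w, rfl⟩ := Sym2.mem_iff_exists.1 hv₂
    obtain rfl := hproper v u w h₁ h₂ heq
    exact hne rfl
  · rintro v ⟨e₁, h₁⟩ ⟨e₂, h₂⟩ hv₁ hv₂ k hk₁ hk₂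
    obtain ⟨u, rfl⟩ := Sym2.mem_iff_exists.1 hv₁
    obtain ⟨w, rfl⟩ := Sym2.mem_iff_exists.1 hv₂
    obtain ⟨z, hz, hzk⟩ := hinterval v u w h₁ h₂ k hk₁ hk₂
    exact ⟨⟨s(v, z), hz⟩, Sym2.mem_mk_left v z, hzk⟩

theorem stmt_12 {V : Type*} [Fintype V] (G : SimpleGraph V)
    (hbip : IsBipartite G) (hedge : G.edgeSet.Nonempty)
    (hdeg : ∀ v : V, (G.neighborSet v).ncard ≤ 3) :
    IntervalColorable G := by
  obtain ⟨X, Y, hdisj, -, hXY⟩ := hbip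
  have hX : ∀ u v, G.Adj u v → (u ∈ X ↔ v ∉ X) := fun u v h => by
    rcases hXY u v h with ⟨hu, hv⟩ | ⟨hu, hv⟩
    · exact iff_of_true hu fun h' => Set.disjoint_left.1 hdisj h' hv
    · exact iff_of_false (fun h' => Set.disjoint_left.1 hdisj h' hu) (not_not.2 hv)
  obtain ⟨c, hc⟩ := G.exists_isLocallyIntervalColoring hX hdeg
  exact hc.intervalColorable hedge
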